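/- For every θ with 0 < θ < π/2, the inverse tangent integral satisfies Ti₂(tan θ) = θ·log(tan θ) + (1/2)·Cl₂(2θ) + (1/2)·Cl₂(π − 2θ). -/

import Mathlib

open scoped Real

/-- The inverse tangent integral `Ti₂(y) = ∫₀^y arctan(x)/x dx`. -/
noncomputable def Ti2 (y : ℝ) : ℝ :=
  ∫ x in (0:ℝ)..y, Real.arctan x / x

/-- The Clausen function `Cl₂(φ) = −∫₀^φ log(2 sin(t/2)) dt`. -/
noncomputable def Cl2 (φ : ℝ) : ℝ :=
  -∫ t in (0:ℝ)..φ, Real.log (2 * Real.sin (t / 2))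

open MeasureTheory Set

/-- The continuous extension of `arctan x / x`. -/
theorem continuous_dslope_arctan : Continuous (dslope Real.arctan 0) := by
  rw [← continuousOn_univ, continuousOn_dslope Filter.univ_mem]
  exact ⟨Real.continuous_arctan.continuousOn, Real.differentiable_arctan 0⟩

theorem dslope_arctan_of_ne {x : ℝ} (hx : x ≠ 0) :
    dslope Real.arctan 0 x = Real.arctan x / x := by
  rw [dslope_of_ne _ hx, slope_def_field, Real.arctan_zero, sub_zero, sub_zero]

theorem Ti2_eq_integral_dslope (y : ℝ) :
    Ti2 y = ∫ x in (0:ℝ)..y, dslope Real.arctan 0 x := by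
  refine intervalIntegral.integral_congr_ae ?_
  filter_upwards [Measure.ae_ne volume (0 : ℝ)] with x hx _
  exact (dslope_arctan_of_ne hx).symm

theorem hasDerivAt_Ti2 (y : ℝ) : HasDerivAt Ti2 (dslope Real.arctan 0 y) y := by
  rw [funext Ti2_eq_integral_dslope]
  exact (continuous_dslope_arctan.integral_hasStrictDerivAt 0 y).hasDerivAt

theorem continuous_Ti2 : Continuous Ti2 :=
  continuous_iff_continuousAt.2 fun y ↦ (hasDerivAt_Ti2 y).continuousAt

theorem continuous_arctan_mul_log : Continuous fun y : ℝ ↦ Real.arctan y * Real.log y := by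
  have h : (fun y : ℝ ↦ Real.arctan y * Real.log y)
      = fun y ↦ dslope Real.arctan 0 y * (y * Real.log y) := by
    funext y
    rcases eq_or_ne y 0 with rfl | hy
    · simp
    · rw [dslope_arctan_of_ne hy]
      field_simp
  rw [h]
  exact continuous_dslope_arctan.mul Real.continuous_mul_log

theorem intervalIntegrable_log_two_mul_sin_half (a b : ℝ) :
    IntervalIntegrable (fun t ↦ Real.log (2 * Real.sin (t / 2))) volume a b := by
  have h : AnalyticOnNhd ℝ (fun t : ℝ ↦ 2 * Real.sin (t / 2)) (uIcc a b) := fun t _ ↦ by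
    fun_prop
  exact h.meromorphicOn.intervalIntegrable_log

theorem continuous_Cl2 : Continuous Cl2 :=
  (intervalIntegral.continuous_primitive intervalIntegrable_log_two_mul_sin_half 0).neg

theorem hasDerivAt_Cl2 {φ : ℝ} (h : Real.sin (φ / 2) ≠ 0) :
    HasDerivAt Cl2 (-Real.log (2 * Real.sin (φ / 2))) φ := by
  refine (intervalIntegral.integral_hasDerivAt_right
    (intervalIntegrable_log_two_mul_sin_half 0 φ) ?_ ?_).fun_neg
  · exact (Measurable.stronglyMeasurable (by fun_prop)).stronglyMeasurableAtFilter
  · exact ContinuousAt.log (by fun_prop) (by simpa using h)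

theorem Cl2_zero : Cl2 0 = 0 := by simp [Cl2]

theorem Cl2_pi : Cl2 π = 0 := by
  have h : ∫ x in (0:ℝ)..(π / 2), Real.log (2 * Real.sin x)
      = ∫ x in (0:ℝ)..(π / 2), (Real.log 2 + Real.log (Real.sin x)) := by
    refine intervalIntegral.integral_congr_Ioo_of_le Real.pi_div_two_pos.le fun x hx ↦ ?_
    have hs : 0 < Real.sin x := Real.sin_pos_of_pos_of_lt_pi hx.1 (by linarith [hx.2, hx.1])
    exact Real.log_mul two_ne_zero hs.ne'
  rw [Cl2, intervalIntegral.integral_comp_div (fun x ↦ Real.log (2 * Real.sin x)) two_ne_zero,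
    zero_div, h, intervalIntegral.integral_add (by simp)
      (g := fun x ↦ Real.log (Real.sin x)) intervalIntegrable_log_sin,
    integral_log_sin_zero_pi_div_two]
  simp
  ring

theorem stmt_16 (θ : ℝ) (hθ0 : 0 < θ) (hθ1 : θ < π / 2) :
    Ti2 (Real.tan θ) = θ * Real.log (Real.tan θ)
      + 1 / 2 * Cl2 (2 * θ) + 1 / 2 * Cl2 (π - 2 * θ) := by
  have hcos : ∀ x ∈ Icc 0 θ, 0 < Real.cos x := fun x hx ↦
    Real.cos_pos_of_mem_Ioo ⟨by linarith [hx.1], by linarith [hx.2]⟩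
  have htan : ContinuousOn Real.tan (Icc 0 θ) := fun x hx ↦
    (Real.continuousAt_tan.2 (hcos x hx).ne').continuousWithinAt
  have hlog : ContinuousOn (fun x ↦ x * Real.log (Real.tan x)) (Icc 0 θ) := by
    refine (continuous_arctan_mul_log.comp_continuousOn htan).congr fun x hx ↦ ?_
    simp only [Function.comp_apply]
    rw [Real.arctan_tan (by linarith [hx.1]) (by linarith [hx.2])]
  have hcl : Continuous fun x ↦ 1 / 2 * Cl2 (2 * x) + 1 / 2 * Cl2 (π - 2 * x) :=
    ((continuous_Cl2.comp (by fun_prop)).const_mul _).add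
      ((continuous_Cl2.comp (by fun_prop)).const_mul _)
  obtain ⟨c, -, hc⟩ := exists_hasDerivAt_eq_slope
    (fun x ↦ Ti2 (Real.tan x) - x * Real.log (Real.tan x)
      - (1 / 2 * Cl2 (2 * x) + 1 / 2 * Cl2 (π - 2 * x))) (fun _ ↦ 0) hθ0
    (((continuous_Ti2.comp_continuousOn htan).sub hlog).sub hcl.continuousOn) fun x hx ↦ by
      have hc := hcos x (Ioo_subset_Icc_self hx)
      have hs : 0 < Real.sin x :=
        Real.sin_pos_of_pos_of_lt_pi hx.1 (by linarith [hx.1, hx.2])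
      have ht : Real.tan x ≠ 0 := by rw [Real.tan_eq_sin_div_cos]; positivity
      have e1 : 2 * x / 2 = x := by ring
      have e2 : (π - 2 * x) / 2 = π / 2 - x := by ring
      have dt := Real.hasDerivAt_tan hc.ne'
      have d1 := (hasDerivAt_Ti2 (Real.tan x)).comp x dt
      have d2 := (hasDerivAt_id x).mul (dt.log ht)
      have d3 := ((hasDerivAt_Cl2 (φ := 2 * x) (by rw [e1]; exact hs.ne')).comp x
        ((hasDerivAt_id x).const_mul 2)).const_mul (1 / 2)
      have d4 := ((hasDerivAt_Cl2 (φ := π - 2 * x)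
        (by rw [e2, Real.sin_pi_div_two_sub]; exact hc.ne')).comp x
        (((hasDerivAt_id x).const_mul 2).const_sub π)).const_mul (1 / 2)
      refine ((d1.sub d2).sub (d3.add d4)).congr_deriv ?_
      rw [e1, e2, Real.sin_pi_div_two_sub, dslope_arctan_of_ne ht,
        Real.arctan_tan (by linarith [hx.1]) (by linarith [hx.2]),
        Real.tan_eq_sin_div_cos, Real.log_div hs.ne' hc.ne',
        Real.log_mul two_ne_zero hs.ne', Real.log_mul two_ne_zero hc.ne']
      simp only [id]
      field_simp
      ring
  have h0 := (div_eq_zero_iff.1 hc.symm).resolve_right (by linarith)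
  have hTi : Ti2 0 = 0 := by simp [Ti2]
  simp only [Real.tan_zero, hTi, mul_zero, sub_zero, Cl2_zero, Cl2_pi, zero_mul, add_zero] at h0
  linarith
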